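/- Fischer-type decomposition for the difference Dirac operator: let k ≥ 1 and fix a sign choice. Every P ∈ Π_k^± can be written uniquely as P = M + (mh)·Q, where M ∈ Π_k^± satisfies D_h^± M = 0 and Q ∈ Π_{k−1}^±; here (mh)·Q is the lattice function m ↦ (mh)·Q(m) (pointwise left multiplication by the Clifford vector mh). -/

import Mathlib

open Finset

noncomputable section

/-- The quadratic form on `ℝⁿ` whose Clifford algebra is `Cl_{0,n}`:
`Q(x) = −(x₁² + ⋯ + xₙ²)`, so that the generators satisfy `eᵢeⱼ + eⱼeᵢ = −2δᵢⱼ`. -/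
def negQ (n : ℕ) : QuadraticForm ℝ (Fin n → ℝ) :=
  QuadraticMap.weightedSumSquares ℝ (fun _ : Fin n => (-1 : ℝ))

/-- The Clifford algebra `Cl_{0,n}`. -/
abbrev Cl (n : ℕ) := CliffordAlgebra (negQ n)

/-- The generators `e i` of `Cl_{0,n}`. -/
def eCl (n : ℕ) (i : Fin n) : Cl n := CliffordAlgebra.ι (negQ n) (Pi.single i 1)

/-- `1` for the forward (upper sign) choice, `-1` for the backward one. -/
def sgn (σ : Bool) : ℝ := if σ then 1 else -1

/-- Forward/backward difference `∂_h^{±i}` of a lattice function with values in a real module. -/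
def fdiff {n : ℕ} {A : Type*} [AddCommGroup A] [Module ℝ A] (σ : Bool) (h : ℝ) (i : Fin n)
    (f : (Fin n → ℤ) → A) : (Fin n → ℤ) → A := fun m =>
  if σ then h⁻¹ • (f (m + Pi.single i 1) - f m) else h⁻¹ • (f m - f (m - Pi.single i 1))

/-- `m ∓ εᵢ` (upper sign paired with the forward difference). -/
def shiftB {n : ℕ} (σ : Bool) (i : Fin n) (m : Fin n → ℤ) : Fin n → ℤ :=
  if σ then m - Pi.single i 1 else m + Pi.single i 1

/-- One-dimensional factorial power `(x)_∓^{(s)} = ∏_{k=0}^{s-1} (x ∓ k h)`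
(upper sign paired with the forward difference `σ = true`). -/
def factPow (σ : Bool) (h x : ℝ) (s : ℕ) : ℝ :=
  ∏ k ∈ range s, (x - sgn σ * k * h)

/-- Multi-index factorial power `(mh)_∓^{(α)}`. -/
def mfp {n : ℕ} (σ : Bool) (h : ℝ) (m : Fin n → ℤ) (α : Fin n → ℕ) : ℝ :=
  ∏ i, factPow σ h (m i * h) (α i)

/-- The difference Dirac operator `D_h^± = Σᵢ eᵢ ∂_h^{±i}`. -/
def Dirac (n : ℕ) (σ : Bool) (h : ℝ) (f : (Fin n → ℤ) → Cl n) : (Fin n → ℤ) → Cl n :=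
  fun m => ∑ i, eCl n i * fdiff σ h i f m

/-- The Clifford vector `mh = Σᵢ (mᵢ h) eᵢ`. -/
def vecCl (n : ℕ) (h : ℝ) (m : Fin n → ℤ) : Cl n := ∑ i, ((m i : ℝ) * h) • eCl n i

/-- The difference Euler operator `(E_h^± f)(m) = Σᵢ (mᵢ h) (∂_h^{±i} f)(m ∓ εᵢ)`. -/
def Euler (n : ℕ) (σ : Bool) (h : ℝ) (f : (Fin n → ℤ) → Cl n) : (Fin n → ℤ) → Cl n :=
  fun m => ∑ i, ((m i : ℝ) * h) • fdiff σ h i f (shiftB σ i m)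

/-- The second-order operator `(A_h^± f)(m) = ∓ h Σᵢ (mᵢ h) (∂_h^{±i} ∂_h^{∓i} f)(m)`. -/
def Aop (n : ℕ) (σ : Bool) (h : ℝ) (f : (Fin n → ℤ) → Cl n) : (Fin n → ℤ) → Cl n :=
  fun m => (-(sgn σ) * h) • ∑ i, ((m i : ℝ) * h) • fdiff σ h i (fdiff (!σ) h i f) m

/-- `L_{jk}^± f = (mⱼ h) ∂_h^{±k} f − (m_k h) ∂_h^{±j} f`. -/
def Lop (n : ℕ) (σ : Bool) (h : ℝ) (j k : Fin n) (f : (Fin n → ℤ) → Cl n) :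
    (Fin n → ℤ) → Cl n :=
  fun m => ((m j : ℝ) * h) • fdiff σ h k f m - ((m k : ℝ) * h) • fdiff σ h j f m

/-- The difference Gamma operator `Γ_h^± f = −Σ_{j<k} eⱼ e_k L_{jk}^± f − A_h^± f`. -/
def Gamma (n : ℕ) (σ : Bool) (h : ℝ) (f : (Fin n → ℤ) → Cl n) : (Fin n → ℤ) → Cl n :=
  fun m => -(∑ j, ∑ k, if j < k then eCl n j * eCl n k * Lop n σ h j k f m else 0)
    - Aop n σ h f m

/-- `B_h^± = ±h Σᵢ ∂_h^{±i}`. -/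
def Bop (n : ℕ) (σ : Bool) (h : ℝ) (f : (Fin n → ℤ) → Cl n) : (Fin n → ℤ) → Cl n :=
  fun m => (sgn σ * h) • ∑ i, fdiff σ h i f m

/-- `(C_h^± f)(m) = Σᵢ (mᵢ h) eᵢ f(m ∓ εᵢ)`. -/
def Cop (n : ℕ) (σ : Bool) (h : ℝ) (f : (Fin n → ℤ) → Cl n) : (Fin n → ℤ) → Cl n :=
  fun m => ∑ i, ((m i : ℝ) * h) • (eCl n i * f (shiftB σ i m))

/-- `V_{h,r}^± = r I + E_h^± − A_h^± + (1/2) B_h^±`. -/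
def Vop (n : ℕ) (σ : Bool) (h r : ℝ) (f : (Fin n → ℤ) → Cl n) : (Fin n → ℤ) → Cl n :=
  fun m => r • f m + Euler n σ h f m - Aop n σ h f m + (1/2 : ℝ) • Bop n σ h f m

/-- `Π_k^±`: the real span of the lattice functions `m ↦ (mh)_∓^{(α)} a` with `|α| ≤ k`. -/
def PiLe (n : ℕ) (σ : Bool) (h : ℝ) (k : ℕ) : Submodule ℝ ((Fin n → ℤ) → Cl n) :=
  Submodule.span ℝ {f | ∃ (α : Fin n → ℕ) (a : Cl n),
    (∑ i, α i) ≤ k ∧ f = fun m => mfp σ h m α • a}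

/-- The space of homogeneous discrete polynomials of degree exactly `k`:
the real span of the lattice functions `m ↦ (mh)_∓^{(α)} a` with `|α| = k`. -/
def PiEq (n : ℕ) (σ : Bool) (h : ℝ) (k : ℕ) : Submodule ℝ ((Fin n → ℤ) → Cl n) :=
  Submodule.span ℝ {f | ∃ (α : Fin n → ℕ) (a : Cl n),
    (∑ i, α i) = k ∧ f = fun m => mfp σ h m α • a}

/-- Lattice functions with values in `Cl_{0,n}`. -/
abbrev LatticeFun (n : ℕ) := (Fin n → ℤ) → Cl n

theorem eCl_mul_add_swap (n : ℕ) (i j : Fin n) :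
    eCl n i * eCl n j + eCl n j * eCl n i = if i = j then (-2 : ℝ) • (1 : Cl n) else 0 := by
  rw [eCl, eCl, CliffordAlgebra.ι_mul_ι_add_swap, Algebra.algebraMap_eq_smul_one]
  have hQ : QuadraticMap.polar (negQ n) (Pi.single i 1) (Pi.single j 1)
      = if i = j then (-2 : ℝ) else 0 := by
    simp only [QuadraticMap.polar, negQ, QuadraticMap.weightedSumSquares_apply, Pi.add_apply,
      smul_eq_mul, ← Finset.sum_sub_distrib]
    have : ∀ x : Fin n, -1 * (((Pi.single i 1 : Fin n → ℝ) x + (Pi.single j 1 : Fin n → ℝ) x)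
          * ((Pi.single i 1 : Fin n → ℝ) x + (Pi.single j 1 : Fin n → ℝ) x))
        - -1 * ((Pi.single i 1 : Fin n → ℝ) x * (Pi.single i 1 : Fin n → ℝ) x)
        - -1 * ((Pi.single j 1 : Fin n → ℝ) x * (Pi.single j 1 : Fin n → ℝ) x)
        = (Pi.single i 1 : Fin n → ℝ) x * (-2 * (Pi.single j 1 : Fin n → ℝ) x) := fun x => by ring
    simp_rw [this]
    by_cases hij : i = j
    · simp [Pi.single_apply, hij]
    · simp [Pi.single_apply, hij, Ne.symm hij]
  rw [hQ]
  split_ifs <;> simp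

/-- The partial difference `∂_h^{±i}` as a linear operator. -/
def diffLin (n : ℕ) (σ : Bool) (h : ℝ) (i : Fin n) : Module.End ℝ (LatticeFun n) where
  toFun := fdiff σ h i
  map_add' f g := by
    ext m
    cases σ <;> simp [fdiff, ← smul_add] <;> abel_nf
  map_smul' c f := by
    ext m
    cases σ <;> simp [fdiff, ← smul_sub, smul_comm c]

/-- The raising operator `f ↦ (m ↦ (mᵢ h) f(m ∓ εᵢ))`. -/
def raiseLin (n : ℕ) (σ : Bool) (h : ℝ) (i : Fin n) : Module.End ℝ (LatticeFun n) where
  toFun f m := ((m i : ℝ) * h) • f (shiftB σ i m)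
  map_add' f g := by
    ext m
    simp
  map_smul' c f := by
    ext m
    simp [smul_comm c]

/-- Pointwise left multiplication by a Clifford number. -/
def mulLeftLin (n : ℕ) (a : Cl n) : Module.End ℝ (LatticeFun n) where
  toFun f m := a * f m
  map_add' f g := by
    ext m
    simp [mul_add]
  map_smul' c f := by
    ext m
    simp

/-- `D_h^±` as a linear operator. -/
def diracLin (n : ℕ) (σ : Bool) (h : ℝ) : Module.End ℝ (LatticeFun n) :=
  ∑ i, mulLeftLin n (eCl n i) * diffLin n σ h i

/-- `C_h^±` as a linear operator. -/
def copLin (n : ℕ) (σ : Bool) (h : ℝ) : Module.End ℝ (LatticeFun n) :=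
  ∑ i, mulLeftLin n (eCl n i) * raiseLin n σ h i

/-- `E_h^±` as a linear operator. -/
def eulerLin (n : ℕ) (σ : Bool) (h : ℝ) : Module.End ℝ (LatticeFun n) :=
  ∑ i, raiseLin n σ h i * diffLin n σ h i

/-- The degree-preserving part `±h Σᵢ eᵢ Xᵢ ∂ᵢ` of multiplication by `mh`,
with `Xᵢ` the raising operators. -/
def vecDiagLin (n : ℕ) (σ : Bool) (h : ℝ) : Module.End ℝ (LatticeFun n) :=
  (sgn σ * h) • ∑ i, mulLeftLin n (eCl n i) * (raiseLin n σ h i * diffLin n σ h i)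

section Relations

variable (n : ℕ) (σ : Bool) (h : ℝ)

theorem diracLin_apply (f : LatticeFun n) : diracLin n σ h f = Dirac n σ h f := by
  ext m
  simp [diracLin, Dirac, mulLeftLin, diffLin, LinearMap.sum_apply, Finset.sum_apply]

theorem mulLeftLin_mul_diffLin (a : Cl n) (i : Fin n) :
    mulLeftLin n a * diffLin n σ h i = diffLin n σ h i * mulLeftLin n a := by
  ext f m
  cases σ <;> simp [mulLeftLin, diffLin, fdiff, mul_sub]

theorem mulLeftLin_mul_raiseLin (a : Cl n) (i : Fin n) :
    mulLeftLin n a * raiseLin n σ h i = raiseLin n σ h i * mulLeftLin n a := by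
  ext f m
  simp [mulLeftLin, raiseLin]

theorem mulLeftLin_mul (a b : Cl n) :
    mulLeftLin n a * mulLeftLin n b = mulLeftLin n (a * b) := by
  ext f m
  simp [mulLeftLin, mul_assoc]

theorem mulLeftLin_add (a b : Cl n) :
    mulLeftLin n a + mulLeftLin n b = mulLeftLin n (a + b) := by
  ext f m
  simp [mulLeftLin, add_mul]

theorem raiseLin_mul_comm (i j : Fin n) :
    raiseLin n σ h i * raiseLin n σ h j = raiseLin n σ h j * raiseLin n σ h i := by
  by_cases hij : i = j
  · rw [hij]
  ext f m
  have hs : shiftB σ j (shiftB σ i m) = shiftB σ i (shiftB σ j m) := by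
    cases σ <;> simp [shiftB] <;> abel
  have hi : shiftB σ i m j = m j := by
    cases σ <;> simp [shiftB, Ne.symm hij]
  have hj : shiftB σ j m i = m i := by
    cases σ <;> simp [shiftB, hij]
  simp [raiseLin, hs, hi, hj, smul_smul, mul_comm]

theorem diffLin_mul_raiseLin (hh : h ≠ 0) (i j : Fin n) :
    diffLin n σ h i * raiseLin n σ h j
      = raiseLin n σ h j * diffLin n σ h i + if i = j then 1 else 0 := by
  ext f m
  by_cases hij : i = j
  · subst hij
    cases σ
    · simp [diffLin, raiseLin, fdiff, shiftB, sub_mul, sub_smul, smul_sub, smul_smul, hh,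
        mul_comm h⁻¹]
      abel
    · simp [diffLin, raiseLin, fdiff, shiftB, add_mul, add_smul, smul_sub, smul_smul, hh,
        mul_comm h⁻¹]
      abel
  · cases σ
    · simp [diffLin, raiseLin, fdiff, shiftB, smul_sub, smul_smul, hij, Ne.symm hij,
        mul_comm h⁻¹, add_sub_right_comm]
    · simp [diffLin, raiseLin, fdiff, shiftB, smul_sub, smul_smul, hij, Ne.symm hij,
        mul_comm h⁻¹, sub_add_eq_add_sub]

theorem diracLin_mul_copLin (hh : h ≠ 0) :
    diracLin n σ h * copLin n σ h
      = -(2 : ℝ) • eulerLin n σ h - (n : ℝ) • 1 - copLin n σ h * diracLin n σ h := by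
  rw [eq_sub_iff_add_eq]
  have key : ∀ i j : Fin n,
      mulLeftLin n (eCl n i) * diffLin n σ h i * (mulLeftLin n (eCl n j) * raiseLin n σ h j)
        + mulLeftLin n (eCl n j) * raiseLin n σ h j * (mulLeftLin n (eCl n i) * diffLin n σ h i)
      = if i = j then
          -(2 : ℝ) • (raiseLin n σ h i * diffLin n σ h i) - 1
        else 0 := by
    intro i j
    have h1 : mulLeftLin n (eCl n i) * diffLin n σ h i
          * (mulLeftLin n (eCl n j) * raiseLin n σ h j)
        = mulLeftLin n (eCl n i * eCl n j) * (diffLin n σ h i * raiseLin n σ h j) := by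
      rw [← mulLeftLin_mul, mul_assoc, ← mul_assoc (diffLin n σ h i), ← mulLeftLin_mul_diffLin]
      simp only [mul_assoc]
    have h2 : mulLeftLin n (eCl n j) * raiseLin n σ h j
          * (mulLeftLin n (eCl n i) * diffLin n σ h i)
        = mulLeftLin n (eCl n j * eCl n i) * (raiseLin n σ h j * diffLin n σ h i) := by
      rw [← mulLeftLin_mul, mul_assoc, ← mul_assoc (raiseLin n σ h j), ← mulLeftLin_mul_raiseLin]
      simp only [mul_assoc]
    rw [h1, h2, diffLin_mul_raiseLin n σ h hh, mul_add, add_right_comm, ← add_mul,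
      mulLeftLin_add, eCl_mul_add_swap]
    have hsq : eCl n i * eCl n i = (-1 : ℝ) • 1 := by
      have := eCl_mul_add_swap n i i
      rw [if_pos rfl, ← two_smul ℝ] at this
      have h3 := congrArg (fun x => (2⁻¹ : ℝ) • x) this
      simp only [smul_smul] at h3
      norm_num at h3 ⊢
      exact h3
    split_ifs with hij
    · subst hij
      rw [hsq]
      ext f m
      simp [mulLeftLin, sub_eq_add_neg]
    · ext f m
      simp [mulLeftLin]
  rw [diracLin, copLin, Finset.sum_mul_sum, Finset.sum_mul_sum, Finset.sum_comm (γ := Fin n),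
    ← Finset.sum_add_distrib]
  simp_rw [← Finset.sum_add_distrib]
  rw [Finset.sum_comm]
  simp_rw [key]
  simp only [Finset.sum_ite_eq, Finset.mem_univ, if_true, Finset.sum_sub_distrib, eulerLin,
    ← Finset.smul_sum]
  simp only [Finset.sum_const, Finset.card_univ, Fintype.card_fin, Nat.cast_smul_eq_nsmul]

theorem eulerLin_mul_raiseLin (hh : h ≠ 0) (j : Fin n) :
    eulerLin n σ h * raiseLin n σ h j
      = raiseLin n σ h j * eulerLin n σ h + raiseLin n σ h j := by
  simp_rw [eulerLin, Finset.sum_mul, Finset.mul_sum, mul_assoc, diffLin_mul_raiseLin n σ h hh,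
    mul_add, ← mul_assoc, raiseLin_mul_comm n σ h _ j, Finset.sum_add_distrib]
  simp

theorem vecCl_mul_eq (hh : h ≠ 0) (f : LatticeFun n) :
    (fun m => vecCl n h m * f m) = copLin n σ h f + vecDiagLin n σ h f := by
  ext m
  simp only [vecCl, copLin, vecDiagLin, LinearMap.sum_apply, LinearMap.smul_apply, Pi.add_apply,
    Pi.smul_apply, Finset.sum_apply, Finset.sum_mul, Finset.smul_sum, ← Finset.sum_add_distrib]
  refine Finset.sum_congr rfl fun i _ => ?_
  cases σ <;> simp [mulLeftLin, raiseLin, diffLin, fdiff, shiftB, sgn, smul_smul, mul_sub,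
    smul_sub, hh] <;> field_simp <;> simp

end Relations

section Degree

variable {n : ℕ} {σ : Bool} {h : ℝ}

theorem raiseLin_mfp (i : Fin n) (α : Fin n → ℕ) (a : Cl n) :
    raiseLin n σ h i (fun m => mfp σ h m α • a)
      = fun m => mfp σ h m (α + Pi.single i 1) • a := by
  ext m
  simp only [raiseLin, LinearMap.coe_mk, AddHom.coe_mk, smul_smul]
  congr 1
  simp only [mfp]
  rw [← Finset.mul_prod_erase _ _ (Finset.mem_univ i),
    ← Finset.mul_prod_erase _ _ (Finset.mem_univ i), ← mul_assoc]
  congr 1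
  · simp only [factPow, Pi.add_apply, Pi.single_eq_same, Finset.prod_range_succ']
    rw [mul_comm]
    congr 1
    · refine Finset.prod_congr rfl fun k _ => ?_
      cases σ <;> simp [shiftB, sgn] <;> ring
    · simp
  · refine Finset.prod_congr rfl fun j hj => ?_
    have hji := Finset.ne_of_mem_erase hj
    cases σ <;> simp [shiftB, hji]

theorem mfp_mem_PiEq (α : Fin n → ℕ) (a : Cl n) {k : ℕ} (hα : ∑ i, α i = k) :
    (fun m => mfp σ h m α • a) ∈ PiEq n σ h k :=
  Submodule.subset_span ⟨α, a, hα, rfl⟩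

theorem sum_add_single (α : Fin n → ℕ) (i : Fin n) :
    ∑ j, (α + Pi.single i 1 : Fin n → ℕ) j = ∑ j, α j + 1 := by
  simp [Finset.sum_add_distrib]

theorem raiseLin_mem_PiEq (i : Fin n) {k : ℕ} {f : LatticeFun n} (hf : f ∈ PiEq n σ h k) :
    raiseLin n σ h i f ∈ PiEq n σ h (k + 1) := by
  induction hf using Submodule.span_induction with
  | mem f hf =>
    obtain ⟨α, a, hα, rfl⟩ := hf
    rw [raiseLin_mfp]
    exact mfp_mem_PiEq _ _ (by rw [sum_add_single, hα])
  | zero => simp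
  | add f g _ _ hf hg => simpa using add_mem hf hg
  | smul c f _ hf => simpa using Submodule.smul_mem _ c hf

theorem mulLeftLin_mem_PiEq (b : Cl n) {k : ℕ} {f : LatticeFun n} (hf : f ∈ PiEq n σ h k) :
    mulLeftLin n b f ∈ PiEq n σ h k := by
  induction hf using Submodule.span_induction with
  | mem f hf =>
    obtain ⟨α, a, hα, rfl⟩ := hf
    have : mulLeftLin n b (fun m => mfp σ h m α • a) = fun m => mfp σ h m α • (b * a) := by
      ext m
      simp [mulLeftLin]
    rw [this]
    exact mfp_mem_PiEq _ _ hα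
  | zero => simp
  | add f g _ _ hf hg => simpa using add_mem hf hg
  | smul c f _ hf => simpa using Submodule.smul_mem _ c hf

/-- Homogeneous polynomials of positive degree are spanned by raised ones. -/
theorem PiEq_succ_le {k : ℕ} {S : Submodule ℝ (LatticeFun n)}
    (hS : ∀ i, ∀ f ∈ PiEq n σ h k, raiseLin n σ h i f ∈ S) : PiEq n σ h (k + 1) ≤ S := by
  refine Submodule.span_le.2 ?_
  rintro _ ⟨α, a, hα, rfl⟩
  obtain ⟨i, -, hi⟩ : ∃ i ∈ Finset.univ, α i ≠ 0 :=
    Finset.exists_ne_zero_of_sum_ne_zero (by omega)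
  have hαi : α = (α - Pi.single i 1) + Pi.single i 1 := by
    ext j
    by_cases hj : j = i
    · subst hj
      simp
      omega
    · simp [hj]
  have hdeg : ∑ j, (α - Pi.single i 1 : Fin n → ℕ) j = k := by
    have := sum_add_single (α - Pi.single i 1) i
    rw [← hαi] at this
    omega
  rw [hαi, ← raiseLin_mfp]
  exact hS i _ (mfp_mem_PiEq _ _ hdeg)

theorem diffLin_PiEq_zero (i : Fin n) {f : LatticeFun n} (hf : f ∈ PiEq n σ h 0) :
    diffLin n σ h i f = 0 := by
  induction hf using Submodule.span_induction with
  | mem f hf =>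
    obtain ⟨α, a, hα, rfl⟩ := hf
    have hα0 : ∀ i, α i = 0 := by simpa using hα
    ext m
    cases σ <;> simp [diffLin, fdiff, mfp, factPow, hα0]
  | zero => simp
  | add f g _ _ hf hg => simp [hf, hg]
  | smul c f _ hf => simp [hf]

theorem diffLin_mem_PiEq (hh : h ≠ 0) (i : Fin n) {k : ℕ} {f : LatticeFun n}
    (hf : f ∈ PiEq n σ h (k + 1)) : diffLin n σ h i f ∈ PiEq n σ h k := by
  induction k generalizing f with
  | zero =>
    refine PiEq_succ_le (S := (PiEq n σ h 0).comap (diffLin n σ h i)) (fun j g hg => ?_) hf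
    rw [Submodule.mem_comap, ← Module.End.mul_apply, diffLin_mul_raiseLin n σ h hh]
    split_ifs <;> simp [diffLin_PiEq_zero i hg, hg]
  | succ k ih =>
    refine PiEq_succ_le (S := (PiEq n σ h (k + 1)).comap (diffLin n σ h i))
      (fun j g hg => ?_) hf
    rw [Submodule.mem_comap, ← Module.End.mul_apply, diffLin_mul_raiseLin n σ h hh]
    have := raiseLin_mem_PiEq j (ih hg)
    split_ifs <;> simp [this, hg, add_mem]

theorem eulerLin_PiEq (hh : h ≠ 0) {k : ℕ} {f : LatticeFun n} (hf : f ∈ PiEq n σ h k) :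
    eulerLin n σ h f = (k : ℝ) • f := by
  induction k generalizing f with
  | zero => simp [eulerLin, diffLin_PiEq_zero _ hf]
  | succ k ih =>
    refine LinearMap.mem_eqLocus.1 (PiEq_succ_le
      (S := LinearMap.eqLocus (eulerLin n σ h) (((k + 1 : ℕ) : ℝ) • 1)) (fun j g hg => ?_) hf)
    rw [LinearMap.mem_eqLocus, ← Module.End.mul_apply, eulerLin_mul_raiseLin n σ h hh]
    simp [ih hg, add_smul]

theorem diracLin_PiEq_zero {f : LatticeFun n} (hf : f ∈ PiEq n σ h 0) :
    diracLin n σ h f = 0 := by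
  simp [diracLin, diffLin_PiEq_zero _ hf]

theorem diracLin_mem_PiEq (hh : h ≠ 0) {k : ℕ} {f : LatticeFun n}
    (hf : f ∈ PiEq n σ h (k + 1)) : diracLin n σ h f ∈ PiEq n σ h k := by
  rw [diracLin, LinearMap.sum_apply]
  exact sum_mem fun i _ => mulLeftLin_mem_PiEq _ (diffLin_mem_PiEq hh i hf)

theorem copLin_mem_PiEq {k : ℕ} {f : LatticeFun n} (hf : f ∈ PiEq n σ h k) :
    copLin n σ h f ∈ PiEq n σ h (k + 1) := by
  rw [copLin, LinearMap.sum_apply]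
  exact sum_mem fun i _ => mulLeftLin_mem_PiEq _ (raiseLin_mem_PiEq i hf)

theorem vecDiagLin_mem_PiEq (hh : h ≠ 0) {k : ℕ} {f : LatticeFun n} (hf : f ∈ PiEq n σ h k) :
    vecDiagLin n σ h f ∈ PiEq n σ h k := by
  rw [vecDiagLin, LinearMap.smul_apply, LinearMap.sum_apply]
  refine Submodule.smul_mem _ _ (sum_mem fun i _ => mulLeftLin_mem_PiEq _ ?_)
  cases k with
  | zero => simp [diffLin_PiEq_zero i hf]
  | succ k => exact raiseLin_mem_PiEq i (diffLin_mem_PiEq hh i hf)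

theorem diracLin_copLin_PiEq (hh : h ≠ 0) {k : ℕ} {f : LatticeFun n} (hf : f ∈ PiEq n σ h k) :
    diracLin n σ h (copLin n σ h f)
      = -(2 * k + n : ℝ) • f - copLin n σ h (diracLin n σ h f) := by
  rw [← Module.End.mul_apply, diracLin_mul_copLin n σ h hh]
  simp only [LinearMap.sub_apply, LinearMap.smul_apply, Module.End.mul_apply,
    Module.End.one_apply, eulerLin_PiEq hh hf]
  module

/-- The spectrum of `D C` on homogeneous polynomials of degree `k` lies in `[-(2k+n), 0)`:
the operator `D C - c` is bijective on them for every real `c` outside this interval. -/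
theorem diracLin_copLin_sub_bijective (hn : 1 ≤ n) (hh : h ≠ 0) (k : ℕ) (c : ℝ)
    (hc : 0 ≤ c ∨ c < -(2 * k + n : ℝ)) :
    (∀ q ∈ PiEq n σ h k, diracLin n σ h (copLin n σ h q) = c • q → q = 0) ∧
      ∀ p ∈ PiEq n σ h k, ∃ q ∈ PiEq n σ h k,
        diracLin n σ h (copLin n σ h q) - c • q = p := by
  have hn' : (1 : ℝ) ≤ n := by exact_mod_cast hn
  induction k generalizing c with
  | zero =>
    have hcn : -(n : ℝ) - c ≠ 0 := by
      rcases hc with hc | hc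
      · linarith
      · simp at hc
        linarith
    have hdc : ∀ q ∈ PiEq n σ h 0,
        diracLin n σ h (copLin n σ h q) - c • q = (-(n : ℝ) - c) • q := by
      intro q hq
      rw [diracLin_copLin_PiEq hh hq, diracLin_PiEq_zero hq, sub_smul]
      simp
    refine ⟨fun q hq hqc => ?_, fun p hp => ⟨(-(n : ℝ) - c)⁻¹ • p, ?_, ?_⟩⟩
    · have := hdc q hq
      rw [hqc, sub_self] at this
      exact (smul_eq_zero.1 this.symm).resolve_left hcn
    · exact Submodule.smul_mem _ _ hp
    · rw [hdc _ (Submodule.smul_mem _ _ hp), smul_inv_smul₀ hcn]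
  | succ k ih =>
    obtain ⟨l, hl⟩ : ∃ l : ℝ, l = -(2 * (k + 1 : ℕ) + n : ℝ) - c := ⟨_, rfl⟩
    push_cast at hc hl
    have hl' : 0 ≤ l ∨ l < -(2 * k + n : ℝ) := by
      rcases hc with hc | hc
      · right
        linarith
      · left
        linarith
    have hl0 : l ≠ 0 := by
      rcases hc with hc | hc
      · have : (0 : ℝ) ≤ k := by positivity
        linarith
      · linarith
    have hdc : ∀ q ∈ PiEq n σ h (k + 1), diracLin n σ h (copLin n σ h q) - c • q
        = l • q - copLin n σ h (diracLin n σ h q) := by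
      intro q hq
      rw [diracLin_copLin_PiEq hh hq, hl]
      push_cast
      module
    obtain ⟨inj, surj⟩ := ih l hl'
    refine ⟨fun q hq hqc => ?_, fun p hp => ?_⟩
    · have hq' := hdc q hq
      rw [hqc, sub_self, eq_comm, sub_eq_zero] at hq'
      have hD : diracLin n σ h q = 0 := by
        refine inj _ (diracLin_mem_PiEq hh hq) ?_
        rw [← hq', map_smul]
      rw [hD, map_zero] at hq'
      exact (smul_eq_zero.1 hq').resolve_left hl0
    · obtain ⟨r, hr, hrp⟩ := surj _ (neg_mem (diracLin_mem_PiEq hh hp))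
      have hmem : l⁻¹ • (p + copLin n σ h r) ∈ PiEq n σ h (k + 1) :=
        Submodule.smul_mem _ _ (add_mem hp (copLin_mem_PiEq hr))
      refine ⟨_, hmem, ?_⟩
      have hDr : diracLin n σ h (p + copLin n σ h r) = l • r := by
        rw [map_add, sub_eq_iff_eq_add.1 hrp]
        abel
      rw [hdc _ hmem, smul_inv_smul₀ hl0, map_smul, hDr, inv_smul_smul₀ hl0, add_sub_cancel_right]

end Degree

section Filtration

/-- The discrete polynomials of degree less than `k`. -/
def PiLt (n : ℕ) (σ : Bool) (h : ℝ) (k : ℕ) : Submodule ℝ (LatticeFun n) :=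
  ⨆ j ∈ Finset.range k, PiEq n σ h j

variable {n : ℕ} {σ : Bool} {h : ℝ}

theorem PiLt_zero : PiLt n σ h 0 = ⊥ := by
  simp [PiLt]

theorem PiLt_succ (k : ℕ) : PiLt n σ h (k + 1) = PiEq n σ h k ⊔ PiLt n σ h k := by
  simp only [PiLt, Finset.range_add_one, Finset.iSup_insert]

theorem PiEq_le_PiLt {j k : ℕ} (hjk : j < k) : PiEq n σ h j ≤ PiLt n σ h k :=
  le_iSup₂_of_le j (Finset.mem_range.2 hjk) le_rfl

theorem PiLt_mono {j k : ℕ} (hjk : j ≤ k) : PiLt n σ h j ≤ PiLt n σ h k :=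
  iSup₂_le fun _ hi => PiEq_le_PiLt ((Finset.mem_range.1 hi).trans_le hjk)

theorem PiLe_eq_PiLt (k : ℕ) : PiLe n σ h k = PiLt n σ h (k + 1) := by
  apply le_antisymm
  · refine Submodule.span_le.2 ?_
    rintro _ ⟨α, a, hα, rfl⟩
    exact PiEq_le_PiLt (Nat.lt_succ_of_le hα) (mfp_mem_PiEq α a rfl)
  · refine iSup₂_le fun j hj => Submodule.span_mono ?_
    rintro _ ⟨α, a, hα, rfl⟩
    exact ⟨α, a, by have := Finset.mem_range.1 hj; omega, rfl⟩

theorem diracLin_mem_PiLt (hh : h ≠ 0) {k : ℕ} {f : LatticeFun n}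
    (hf : f ∈ PiLt n σ h (k + 1)) : diracLin n σ h f ∈ PiLt n σ h k := by
  refine (iSup₂_le fun j hj g hg => ?_ :
    PiLt n σ h (k + 1) ≤ (PiLt n σ h k).comap (diracLin n σ h)) hf
  rw [Submodule.mem_comap]
  cases j with
  | zero => simp [diracLin_PiEq_zero hg]
  | succ j =>
    have := Finset.mem_range.1 hj
    exact PiEq_le_PiLt (by omega) (diracLin_mem_PiEq hh hg)

/-- Pointwise left multiplication by `mh`, split along the degree. -/
def vecLin (n : ℕ) (σ : Bool) (h : ℝ) : Module.End ℝ (LatticeFun n) :=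
  copLin n σ h + vecDiagLin n σ h

theorem vecLin_mem_PiLt (hh : h ≠ 0) {k : ℕ} {f : LatticeFun n}
    (hf : f ∈ PiLt n σ h k) : vecLin n σ h f ∈ PiLt n σ h (k + 1) := by
  refine (iSup₂_le fun j hj g hg => ?_ :
    PiLt n σ h k ≤ (PiLt n σ h (k + 1)).comap (vecLin n σ h)) hf
  have := Finset.mem_range.1 hj
  exact add_mem (PiEq_le_PiLt (by omega) (copLin_mem_PiEq hg))
    (PiEq_le_PiLt (by omega) (vecDiagLin_mem_PiEq hh hg))

/-- `D (mh)` and `D C` agree on homogeneous polynomials up to lower degree. -/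
theorem diracLin_vecDiagLin_mem (hh : h ≠ 0) {k : ℕ} {f : LatticeFun n}
    (hf : f ∈ PiEq n σ h k) : diracLin n σ h (vecDiagLin n σ h f) ∈ PiLt n σ h k :=
  diracLin_mem_PiLt hh (PiEq_le_PiLt k.lt_succ_self (vecDiagLin_mem_PiEq hh hf))

theorem eq_zero_of_mem_PiLt_of_eulerLin (hh : h ≠ 0) {k : ℕ} {c : ℝ} (hc : (k : ℝ) ≤ c)
    {f : LatticeFun n} (hf : f ∈ PiLt n σ h k) (hE : eulerLin n σ h f = c • f) : f = 0 := by
  induction k with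
  | zero => simpa [PiLt_zero] using hf
  | succ k ih =>
    push_cast at hc
    have hEstable : ∀ g ∈ PiLt n σ h k, eulerLin n σ h g ∈ PiLt n σ h k := by
      intro g hg
      refine (iSup₂_le fun j hj g hg => ?_ :
        PiLt n σ h k ≤ (PiLt n σ h k).comap (eulerLin n σ h)) hg
      rw [Submodule.mem_comap, eulerLin_PiEq hh hg]
      exact Submodule.smul_mem _ _ (PiEq_le_PiLt (Finset.mem_range.1 hj) hg)
    rw [PiLt_succ] at hf
    obtain ⟨u, hu, v, hv, rfl⟩ := Submodule.mem_sup.1 hf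
    refine ih (by linarith) ?_
    have hck : c - k ≠ 0 := by linarith
    have : (c - k) • (u + v) = eulerLin n σ h v - (k : ℝ) • v := by
      rw [sub_smul, ← hE, map_add, eulerLin_PiEq hh hu]
      module
    rw [← inv_smul_smul₀ hck (u + v), this]
    exact Submodule.smul_mem _ _ (sub_mem (hEstable v hv) (Submodule.smul_mem _ _ hv))

theorem diracLin_vecLin_injective (hn : 1 ≤ n) (hh : h ≠ 0) {k : ℕ} {q : LatticeFun n}
    (hq : q ∈ PiLt n σ h k) (h0 : diracLin n σ h (vecLin n σ h q) = 0) : q = 0 := by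
  induction k with
  | zero => simpa [PiLt_zero] using hq
  | succ k ih =>
    rw [PiLt_succ] at hq
    obtain ⟨u, hu, v, hv, rfl⟩ := Submodule.mem_sup.1 hq
    have hDC : diracLin n σ h (copLin n σ h u) ∈ PiLt n σ h k := by
      have : diracLin n σ h (copLin n σ h u) = -(diracLin n σ h (vecDiagLin n σ h u)
          + diracLin n σ h (vecLin n σ h v)) := by
        rw [eq_neg_iff_add_eq_zero, ← h0, ← map_add, ← map_add, map_add (vecLin n σ h),
          ← add_assoc]
        rfl
      rw [this]
      exact neg_mem (add_mem (diracLin_vecDiagLin_mem hh hu)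
        (diracLin_mem_PiLt hh (vecLin_mem_PiLt hh hv)))
    have hDC0 := eq_zero_of_mem_PiLt_of_eulerLin hh le_rfl hDC
      (eulerLin_PiEq hh (diracLin_mem_PiEq hh (copLin_mem_PiEq hu)))
    have hu0 : u = 0 := (diracLin_copLin_sub_bijective hn hh k 0 (Or.inl le_rfl)).1 u hu
      (by rw [hDC0, zero_smul])
    exact ih (by simpa [hu0] using hv)

theorem diracLin_vecLin_surjective (hn : 1 ≤ n) (hh : h ≠ 0) {k : ℕ} {p : LatticeFun n}
    (hp : p ∈ PiLt n σ h k) :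
    ∃ q ∈ PiLt n σ h k, diracLin n σ h (vecLin n σ h q) = p := by
  induction k generalizing p with
  | zero => exact ⟨0, zero_mem _, by simpa [PiLt_zero, eq_comm] using hp⟩
  | succ k ih =>
    rw [PiLt_succ] at hp
    obtain ⟨u, hu, v, hv, rfl⟩ := Submodule.mem_sup.1 hp
    obtain ⟨q, hq, hqu⟩ := (diracLin_copLin_sub_bijective hn hh k 0 (Or.inl le_rfl)).2 u hu
    rw [zero_smul, sub_zero] at hqu
    obtain ⟨r, hr, hrv⟩ := ih (sub_mem hv (diracLin_vecDiagLin_mem hh hq))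
    refine ⟨q + r, add_mem (PiEq_le_PiLt k.lt_succ_self hq) (PiLt_mono k.le_succ hr), ?_⟩
    rw [map_add, map_add, hrv, vecLin, LinearMap.add_apply, map_add, hqu]
    abel

end Filtration

/-- Theorem 3.3 (Fischer-type decomposition): every `P ∈ Π_k^±` can be written
uniquely as `P = M + (mh) Q` with `M ∈ Π_k^±` discrete monogenic and `Q ∈ Π_{k-1}^±`. -/
theorem fischer_decomposition_step (n : ℕ) (hn : 1 ≤ n) (h : ℝ) (hh : 0 < h) (σ : Bool)
    (k : ℕ) (hk : 1 ≤ k) (P : (Fin n → ℤ) → Cl n) (hP : P ∈ PiLe n σ h k) :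
    ∃! MQ : ((Fin n → ℤ) → Cl n) × ((Fin n → ℤ) → Cl n),
      MQ.1 ∈ PiLe n σ h k ∧ Dirac n σ h MQ.1 = 0 ∧ MQ.2 ∈ PiLe n σ h (k - 1) ∧
      P = fun m => MQ.1 m + vecCl n h m * MQ.2 m := by
  have hh0 : h ≠ 0 := hh.ne'
  obtain ⟨k, rfl⟩ := Nat.exists_eq_add_of_le' hk
  simp only [Nat.add_sub_cancel, PiLe_eq_PiLt, ← diracLin_apply] at hP ⊢
  have hvec : ∀ M Q : LatticeFun n,
      (fun m => M m + vecCl n h m * Q m) = M + vecLin n σ h Q := by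
    intro M Q
    rw [vecLin, LinearMap.add_apply, ← vecCl_mul_eq n σ h hh0]
    rfl
  simp only [hvec]
  obtain ⟨Q, hQ, hDQ⟩ := diracLin_vecLin_surjective hn hh0 (diracLin_mem_PiLt hh0 hP)
  refine ⟨(P - vecLin n σ h Q, Q), ⟨sub_mem hP (vecLin_mem_PiLt hh0 hQ), ?_, hQ, ?_⟩, ?_⟩
  · rw [map_sub, hDQ, sub_self]
  · simp
  · rintro ⟨M, Q'⟩ ⟨-, hDM, hQ', hPM⟩
    dsimp only at hDM hQ' hPM
    have hQQ : Q' = Q := by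
      refine sub_eq_zero.1 (diracLin_vecLin_injective hn hh0 (sub_mem hQ' hQ) ?_)
      rw [map_sub, map_sub, hDQ, hPM, map_add, hDM, zero_add, sub_self]
    rw [hPM, hQQ, add_sub_cancel_right]
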